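/- Let h(ρ) = (12/π²) ∫_{-1}^{ρ} arccos(σ²/(3-2σ²))/√(3-σ²) dσ - 1, with power series h(x) = ∑_{k≥0} c_{2k+1} x^{2k+1} about 0, convergent on (-1,1). Then c₁ = 2√3/π > 0 and c_{2k+1} < 0 for all k > 0. -/

import Mathlib

open Real Set

noncomputable section

/-- h(ρ) = (12/π²) ∫_{-1}^{ρ} arccos(σ²/(3-2σ²))/√(3-σ²) dσ - 1. -/
def hOrt2 (ρ : ℝ) : ℝ :=
  (12 / π ^ 2) * (∫ σ in (-1 : ℝ)..ρ, arccos (σ ^ 2 / (3 - 2 * σ ^ 2)) / Real.sqrt (3 - σ ^ 2)) - 1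

/-- A real function agrees on `(-1, 1)` with a power series with nonnegative coefficients. -/
def NonnegPowerSeries (f : ℝ → ℝ) : Prop :=
  ∃ a : ℕ → ℝ, (∀ k, 0 ≤ a k) ∧ ∀ t : ℝ, |t| < 1 → HasSum (fun k => a k * t ^ k) (f t)

/-- Term-by-term integration of a series of monomials with arbitrary exponents. -/
theorem hasSum_integrate_monomials {a : ℕ → ℝ} {p : ℕ → ℕ} {F f : ℝ → ℝ}
    (hf : ∀ t : ℝ, |t| < 1 → HasSum (fun k => a k * t ^ p k) (f t))
    (hF : ∀ t : ℝ, |t| < 1 → HasDerivAt F (f t) t) {x : ℝ} (hx : |x| < 1) :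
    HasSum (fun k => a k / (p k + 1) * x ^ (p k + 1)) (F x - F 0) := by
  obtain ⟨r, hxr, hr1⟩ := exists_between hx
  have hr0 : 0 < r := (abs_nonneg x).trans_lt hxr
  have hsum : Summable (fun k => |a k * r ^ p k|) :=
    (hf r (by rwa [abs_of_pos hr0])).summable.abs
  have hlt : ∀ y ∈ Ioo (-r) r, |y| < 1 := fun y hy => (abs_lt.2 hy).trans hr1
  have hd : ∀ k, ∀ y ∈ Ioo (-r) r, HasDerivAt (fun z => a k / (p k + 1) * z ^ (p k + 1))
      (a k * y ^ p k) y := by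
    intro k y _
    have h := (hasDerivAt_pow (p k + 1) y).const_mul (a k / (p k + 1))
    refine h.congr_deriv ?_
    have : (p k : ℝ) + 1 ≠ 0 := by positivity
    push_cast
    field_simp
  have hb : ∀ k, ∀ y ∈ Ioo (-r) r, ‖a k * y ^ p k‖ ≤ |a k * r ^ p k| := by
    intro k y hy
    rw [Real.norm_eq_abs, abs_mul, abs_mul, abs_pow, abs_pow, abs_of_pos hr0]
    have := (abs_lt.2 hy).le
    gcongr
  have h0 : Summable (fun k => a k / (p k + 1) * (0 : ℝ) ^ (p k + 1)) := by
    simp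
  have hx' : x ∈ Ioo (-r) r := abs_lt.1 hxr
  have h0' : (0 : ℝ) ∈ Ioo (-r) r := ⟨by linarith, hr0⟩
  have hs := summable_of_summable_hasDerivAt_of_isPreconnected hsum isOpen_Ioo isPreconnected_Ioo
    hd hb h0' h0 hx'
  have hG : ∀ y ∈ Ioo (-r) r,
      HasDerivAt (fun z => F 0 + ∑' k, a k / (p k + 1) * z ^ (p k + 1)) (f y) y := by
    intro y hy
    have h := hasDerivAt_tsum_of_isPreconnected hsum isOpen_Ioo isPreconnected_Ioo
      hd hb h0' h0 hy
    rw [(hf y (hlt y hy)).tsum_eq] at h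
    exact h.const_add _
  have heq := isOpen_Ioo.eqOn_of_deriv_eq isPreconnected_Ioo
    (fun y hy => (hF y (hlt y hy)).differentiableAt.differentiableWithinAt)
    (fun y hy => (hG y hy).differentiableAt.differentiableWithinAt)
    (fun y hy => (hF y (hlt y hy)).deriv.trans (hG y hy).deriv.symm) h0' (by simp) hx'
  have := hs.hasSum
  convert! this using 1
  simp only at heq
  rw [heq]
  ring

theorem hasSum_cauchy_product {a b : ℕ → ℝ} {f g t : ℝ}
    (hf : HasSum (fun k => a k * t ^ k) f) (hg : HasSum (fun k => b k * t ^ k) g) :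
    HasSum (fun n => (∑ kl ∈ Finset.HasAntidiagonal.antidiagonal n, a kl.1 * b kl.2) * t ^ n) (f * g) := by
  have h1 := hf.summable.norm
  have h2 := hg.summable.norm
  have h := (summable_norm_sum_mul_antidiagonal_of_summable_norm h1 h2).of_norm.hasSum
  rw [← tsum_mul_tsum_eq_tsum_sum_antidiagonal_of_summable_norm h1 h2, hf.tsum_eq, hg.tsum_eq] at h
  convert! h using 2 with n
  rw [Finset.sum_mul]
  refine Finset.sum_congr rfl fun kl hkl => ?_
  rw [← Finset.HasAntidiagonal.mem_antidiagonal.1 hkl, pow_add]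
  ring

namespace NonnegPowerSeries

variable {f g : ℝ → ℝ}

theorem congr (hf : NonnegPowerSeries f) (h : ∀ t : ℝ, |t| < 1 → g t = f t) :
    NonnegPowerSeries g := by
  obtain ⟨a, ha, hs⟩ := hf
  exact ⟨a, ha, fun t ht => by rw [h t ht]; exact hs t ht⟩

theorem add (hf : NonnegPowerSeries f) (hg : NonnegPowerSeries g) :
    NonnegPowerSeries (fun t => f t + g t) := by
  obtain ⟨a, ha, hs⟩ := hf
  obtain ⟨b, hb, hs'⟩ := hg
  refine ⟨fun k => a k + b k, fun k => add_nonneg (ha k) (hb k), fun t ht => ?_⟩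
  simpa only [add_mul] using (hs t ht).add (hs' t ht)

theorem mul (hf : NonnegPowerSeries f) (hg : NonnegPowerSeries g) :
    NonnegPowerSeries (fun t => f t * g t) := by
  obtain ⟨a, ha, hs⟩ := hf
  obtain ⟨b, hb, hs'⟩ := hg
  exact ⟨_, fun k => Finset.sum_nonneg fun kl _ => mul_nonneg (ha _) (hb _),
    fun t ht => hasSum_cauchy_product (hs t ht) (hs' t ht)⟩

theorem const {c : ℝ} (hc : 0 ≤ c) : NonnegPowerSeries (fun _ => c) := by
  refine ⟨fun k => if k = 0 then c else 0, fun k => by dsimp only; split_ifs <;> simp [hc],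
    fun t _ => ?_⟩
  convert! hasSum_single (f := fun k : ℕ => (if k = 0 then c else 0) * t ^ k) 0 ?_ using 1
  · simp
  · intro k hk
    simp [hk]

theorem id : NonnegPowerSeries (fun t => t) := by
  refine ⟨fun k => if k = 1 then 1 else 0, fun k => by dsimp only; split_ifs <;> simp,
    fun t _ => ?_⟩
  convert! hasSum_single (f := fun k : ℕ => (if k = 1 then 1 else 0) * t ^ k) 1 ?_ using 1
  · simp
  · intro k hk
    simp [hk]

theorem comp_mul_left (hf : NonnegPowerSeries f) {c : ℝ} (hc : 0 ≤ c) (hc1 : c ≤ 1) :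
    NonnegPowerSeries (fun t => f (c * t)) := by
  obtain ⟨a, ha, hs⟩ := hf
  refine ⟨fun k => a k * c ^ k, fun k => mul_nonneg (ha k) (pow_nonneg hc k), fun t ht => ?_⟩
  have h : |c * t| < 1 := by
    rw [abs_mul, abs_of_nonneg hc]
    exact (mul_le_of_le_one_left (abs_nonneg t) hc1).trans_lt ht
  convert! hs _ h using 2
  rw [mul_pow]
  ring

theorem of_hasDerivAt (hf : NonnegPowerSeries f) (hg : ∀ t : ℝ, |t| < 1 → HasDerivAt g (f t) t)
    (h0 : 0 ≤ g 0) : NonnegPowerSeries g := by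
  obtain ⟨a, ha, hs⟩ := hf
  refine ⟨fun k => Nat.casesOn k (g 0) fun n => a n / (n + 1), fun k => ?_, fun t ht => ?_⟩
  · cases k with
    | zero => exact h0
    | succ n => exact div_nonneg (ha n) (by positivity)
  · have h := hasSum_integrate_monomials (p := fun k => k) hs hg ht
    rw [← hasSum_nat_add_iff' 1]
    simpa using h

theorem one_div_one_sub : NonnegPowerSeries (fun t => 1 / (1 - t)) := by
  refine ⟨fun _ => 1, fun _ => zero_le_one, fun t ht => ?_⟩
  simpa using hasSum_geometric_of_abs_lt_one ht

theorem one_div_sqrt_one_sub : NonnegPowerSeries (fun t => 1 / √(1 - t)) := by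
  refine ⟨fun k => Ring.multichoose (1 / 2 : ℝ) k, fun k => ?_, fun t ht => ?_⟩
  · have h := Ring.factorial_nsmul_multichoose_eq_ascPochhammer (1 / 2 : ℝ) k
    rw [nsmul_eq_mul, Polynomial.ascPochhammer_smeval_eq_eval] at h
    have h1 : 0 < (ascPochhammer ℝ k).eval (1 / 2) := ascPochhammer_pos k _ (by norm_num)
    have h2 : (0 : ℝ) < k.factorial := by positivity
    rw [← h] at h1
    exact (pos_of_mul_pos_right h1 h2.le).le
  · have h := (Real.one_div_one_sub_rpow_hasFPowerSeriesOnBall_zero (1 / 2)).hasSum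
      (y := t) (by simpa [Real.enorm_eq_ofReal_abs] using ht)
    simp only [zero_add, ← Real.sqrt_eq_rpow, FormalMultilinearSeries.ofScalars_apply_eq,
      smul_eq_mul] at h
    convert! h using 3 with k
    exact Ring.multichoose_eq (1 / 2 : ℝ) k

theorem one_div_one_sub_mul {c : ℝ} (hc : 0 ≤ c) (hc1 : c ≤ 1) :
    NonnegPowerSeries (fun t => 1 / (1 - c * t)) :=
  one_div_one_sub.comp_mul_left hc hc1

end NonnegPowerSeries

theorem NonnegPowerSeries.exists_pos_coeff_mul_one_div_one_sub_mul {f : ℝ → ℝ}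
    (hf : NonnegPowerSeries f) (h0 : 0 < f 0) {c : ℝ} (hc : 0 < c) (hc1 : c ≤ 1) :
    ∃ d : ℕ → ℝ, (∀ k, 0 < d k) ∧
      ∀ t : ℝ, |t| < 1 → HasSum (fun k => d k * t ^ k) (1 / (1 - c * t) * f t) := by
  obtain ⟨a, ha, hs⟩ := hf
  have ha0 : a 0 = f 0 := by
    have h := (hs 0 (by simp)).unique (hasSum_single 0 fun k hk => by simp [hk])
    simpa using h.symm
  have hgeom : ∀ t : ℝ, |t| < 1 → HasSum (fun k => c ^ k * t ^ k) (1 / (1 - c * t)) := by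
    intro t ht
    have h : |c * t| < 1 := by
      rw [abs_mul, abs_of_pos hc]
      exact (mul_le_of_le_one_left (abs_nonneg t) hc1).trans_lt ht
    simpa [mul_pow] using hasSum_geometric_of_abs_lt_one h
  refine ⟨_, fun k => ?_, fun t ht => hasSum_cauchy_product (hgeom t ht) (hs t ht)⟩
  refine Finset.sum_pos' (fun kl _ => mul_nonneg (by positivity) (ha _)) ⟨(k, 0), by simp, ?_⟩
  rw [ha0]
  positivity

theorem nonnegPowerSeries_one_div_sqrt_three_sub :
    NonnegPowerSeries (fun t => 1 / √(3 - t)) := by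
  refine ((NonnegPowerSeries.const (c := 1 / √3) (by positivity)).mul
    (NonnegPowerSeries.one_div_sqrt_one_sub.comp_mul_left (c := 1 / 3) (by norm_num)
      (by norm_num))).congr fun t _ => ?_
  rw [show (3 : ℝ) - t = 3 * (1 - 1 / 3 * t) by ring, Real.sqrt_mul (by norm_num)]
  ring

theorem nonnegPowerSeries_one_div_three_sub : NonnegPowerSeries (fun t => 1 / (3 - t)) := by
  refine ((NonnegPowerSeries.const (c := 1 / 3) (by positivity)).mul
    (NonnegPowerSeries.one_div_one_sub_mul (c := 1 / 3) (by norm_num)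
      (by norm_num))).congr fun t _ => ?_
  rw [show (3 : ℝ) - t = 3 * (1 - 1 / 3 * t) by ring, one_div_mul_one_div]

theorem nonnegPowerSeries_one_div_three_sub_two_mul :
    NonnegPowerSeries (fun t => 1 / (3 - 2 * t)) := by
  refine ((NonnegPowerSeries.const (c := 1 / 3) (by positivity)).mul
    (NonnegPowerSeries.one_div_one_sub_mul (c := 2 / 3) (by norm_num)
      (by norm_num))).congr fun t _ => ?_
  rw [show (3 : ℝ) - 2 * t = 3 * (1 - 2 / 3 * t) by ring, one_div_mul_one_div]

/-- The function `1 / √((1 - t) (3 - t))`. -/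
def invSqrtProd (t : ℝ) : ℝ := 1 / √(1 - t) * (1 / √(3 - t))

theorem nonnegPowerSeries_invSqrtProd : NonnegPowerSeries invSqrtProd :=
  NonnegPowerSeries.one_div_sqrt_one_sub.mul nonnegPowerSeries_one_div_sqrt_three_sub

theorem hasDerivAt_one_div_sqrt_sub {a t : ℝ} (h : t < a) :
    HasDerivAt (fun t => 1 / √(a - t)) (1 / √(a - t) * (1 / 2 * (1 / (a - t)))) t := by
  have h1 : 0 < a - t := sub_pos.2 h
  have h2 : 0 < √(a - t) := Real.sqrt_pos.2 h1
  have h3 := (((hasDerivAt_id t).const_sub a).sqrt h1.ne').inv h2.ne'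
  simp only [id_eq] at h3
  simp only [one_div]
  refine HasDerivAt.congr_deriv h3 ?_
  rw [Real.sq_sqrt h1.le]
  field_simp

theorem hasDerivAt_invSqrtProd {t : ℝ} (h : t < 1) :
    HasDerivAt invSqrtProd
      (invSqrtProd t * (1 / 2 * (1 / (1 - t) + 1 / (3 - t)))) t := by
  refine ((hasDerivAt_one_div_sqrt_sub h).mul
    (hasDerivAt_one_div_sqrt_sub (by linarith : t < 3))).congr_deriv ?_
  unfold invSqrtProd
  ring

/-- The angle `arccos (t / (3 - 2 t))`. -/
def ortAngle (t : ℝ) : ℝ := arccos (t / (3 - 2 * t))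

theorem hasDerivAt_ortAngle {t : ℝ} (ht : |t| < 1) :
    HasDerivAt ortAngle (-(√3 * (invSqrtProd t * (1 / (3 - 2 * t))))) t := by
  obtain ⟨h1, h2⟩ := abs_lt.1 ht
  have p : 0 < 3 - 2 * t := by linarith
  have p1 : 0 < 1 - t := by linarith
  have p3 : 0 < 3 - t := by linarith
  have hu1 : t / (3 - 2 * t) ≠ -1 := by
    rw [Ne, div_eq_iff p.ne']
    intro h
    linarith
  have hu2 : t / (3 - 2 * t) ≠ 1 := by
    rw [Ne, div_eq_iff p.ne']
    intro h
    linarith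
  have hd : HasDerivAt (fun t : ℝ => t / (3 - 2 * t)) (3 / (3 - 2 * t) ^ 2) t := by
    refine ((hasDerivAt_id t).div (((hasDerivAt_id t).const_mul 2).const_sub 3)
      p.ne').congr_deriv ?_
    simp only [id_eq]
    ring
  refine ((Real.hasDerivAt_arccos hu1 hu2).comp t hd).congr_deriv ?_
  have hs : √(1 - (t / (3 - 2 * t)) ^ 2) = √3 * √(1 - t) * √(3 - t) / (3 - 2 * t) := by
    rw [← Real.sqrt_mul (by norm_num), ← Real.sqrt_mul (by positivity),
      ← Real.sqrt_sq p.le, ← Real.sqrt_div (by positivity), Real.sqrt_sq p.le]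
    congr 1
    have : 3 - t * 2 ≠ 0 := by linarith
    field_simp
    ring
  rw [hs, invSqrtProd]
  have q1 := Real.sqrt_pos.2 p1
  have q3 := Real.sqrt_pos.2 p3
  field_simp
  norm_num

theorem ortAngle_zero : ortAngle 0 = π / 2 := by simp [ortAngle]

/-- The function `√(3 (3 - t) / (1 - t)) - (3 - 2 t) / 2 * arccos (t / (3 - 2 t))`. -/
def ortFactor (t : ℝ) : ℝ :=
  √3 * ((3 - t) * invSqrtProd t) - (3 - 2 * t) / 2 * ortAngle t

theorem invSqrtProd_zero : invSqrtProd 0 = 1 / √3 := by simp [invSqrtProd]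

theorem ortFactor_zero_pos : 0 < ortFactor 0 := by
  have h : √3 ≠ 0 := by positivity
  have := Real.pi_lt_four
  rw [ortFactor, invSqrtProd_zero, ortAngle_zero]
  field_simp
  linarith

theorem hasDerivAt_ortFactor {t : ℝ} (ht : |t| < 1) :
    HasDerivAt ortFactor (√3 * (invSqrtProd t * (1 / 2 + 1 / (1 - t))) + ortAngle t) t := by
  obtain ⟨h1, h2⟩ := abs_lt.1 ht
  have p : 3 - 2 * t ≠ 0 := by linarith
  have p2 : 3 - t * 2 ≠ 0 := by linarith
  have p1 : 1 - t ≠ 0 := by linarith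
  have p3 : 3 - t ≠ 0 := by linarith
  have h3 := (((hasDerivAt_id t).const_sub 3).mul (hasDerivAt_invSqrtProd h2)).const_mul √3
  have h4 := ((((hasDerivAt_id t).const_mul 2).const_sub 3).div_const 2).mul
    (hasDerivAt_ortAngle ht)
  refine (h3.sub h4).congr_deriv ?_
  simp only [id_eq]
  field_simp
  ring

theorem hasDerivAt_deriv_ortFactor {t : ℝ} (ht : |t| < 1) :
    HasDerivAt (fun t => √3 * (invSqrtProd t * (1 / 2 + 1 / (1 - t))) + ortAngle t)
      (√3 * (invSqrtProd t * (1 / 2 * (1 / (1 - t) * (1 / (1 - t))) +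
        t * (1 / (1 - t) * (1 / (1 - t))) + 1 / 2 * (1 / (1 - t) * (1 / (3 - t))) +
        1 / 4 * (1 / (1 - t) + 1 / (3 - t)) +
        1 / (1 - t) * (1 / 2 + 1 / 2 * (1 / (3 - 2 * t)))))) t := by
  obtain ⟨h1, h2⟩ := abs_lt.1 ht
  have p : 3 - 2 * t ≠ 0 := by linarith
  have p2 : 3 - t * 2 ≠ 0 := by linarith
  have p1 : 1 - t ≠ 0 := by linarith
  have p3 : 3 - t ≠ 0 := by linarith
  have h3 := (((hasDerivAt_id t).const_sub 1).inv p1).const_add (1 / 2)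
  have h4 := (((hasDerivAt_invSqrtProd h2).mul h3).const_mul √3).add (hasDerivAt_ortAngle ht)
  simp only [id_eq] at h4
  refine (h4.congr_of_eventuallyEq ?_).congr_deriv ?_
  · exact Filter.Eventually.of_forall fun s => by simp
  · simp only [Pi.inv_apply]
    field_simp
    ring

theorem nonnegPowerSeries_ortFactor : NonnegPowerSeries ortFactor := by
  have g1 := NonnegPowerSeries.one_div_one_sub
  have g3 := nonnegPowerSeries_one_div_three_sub
  have g2 := nonnegPowerSeries_one_div_three_sub_two_mul
  have hh : NonnegPowerSeries (fun _ => (1 / 2 : ℝ)) := .const (by norm_num)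
  have hq : NonnegPowerSeries (fun _ => (1 / 4 : ℝ)) := .const (by norm_num)
  have hs : NonnegPowerSeries (fun _ => √3) := .const (by positivity)
  have h2 := hs.mul (nonnegPowerSeries_invSqrtProd.mul
    (((((hh.mul (g1.mul g1)).add (NonnegPowerSeries.id.mul (g1.mul g1))).add
      (hh.mul (g1.mul g3))).add (hq.mul (g1.add g3))).add (g1.mul (hh.add (hh.mul g2)))))
  refine (h2.of_hasDerivAt (fun t ht => hasDerivAt_deriv_ortFactor ht) ?_).of_hasDerivAt
    (fun t ht => hasDerivAt_ortFactor ht) ortFactor_zero_pos.le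
  rw [invSqrtProd_zero, ortAngle_zero]
  positivity

theorem hasDerivAt_ortAngle_div_sqrt {t : ℝ} (ht : |t| < 1) :
    HasDerivAt (fun t => ortAngle t / √(3 - t))
      (-(1 / (1 - 2 / 3 * t) *
        (1 / 3 * (1 / √(3 - t) * (1 / (3 - t) * ortFactor t))))) t := by
  obtain ⟨h1, h2⟩ := abs_lt.1 ht
  have p : 3 - 2 * t ≠ 0 := by linarith
  have p2 : 3 - t * 2 ≠ 0 := by linarith
  have p' : 1 - 2 / 3 * t ≠ 0 := by linarith
  have p1 : 1 - t ≠ 0 := by linarith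
  have p3 : 3 - t ≠ 0 := by linarith
  have h := (hasDerivAt_ortAngle ht).mul (hasDerivAt_one_div_sqrt_sub (by linarith : t < 3))
  refine (h.congr_of_eventuallyEq ?_).congr_deriv ?_
  · exact Filter.Eventually.of_forall fun s => by simp [div_eq_mul_inv]
  · rw [ortFactor, show 1 - 2 / 3 * t = (3 - 2 * t) / 3 by ring]
    field_simp
    ring

theorem exists_hasSum_ortAngle_div_sqrt :
    ∃ a : ℕ → ℝ, (∀ t : ℝ, |t| < 1 → HasSum (fun k => a k * t ^ k) (ortAngle t / √(3 - t))) ∧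
      a 0 = π / 2 / √3 ∧ ∀ k, 0 < k → a k < 0 := by
  have hK : NonnegPowerSeries
      (fun t => 1 / 3 * (1 / √(3 - t) * (1 / (3 - t) * ortFactor t))) :=
    (NonnegPowerSeries.const (by norm_num)).mul (nonnegPowerSeries_one_div_sqrt_three_sub.mul
      (nonnegPowerSeries_one_div_three_sub.mul nonnegPowerSeries_ortFactor))
  have h0 := ortFactor_zero_pos
  obtain ⟨d, hd, hs⟩ := hK.exists_pos_coeff_mul_one_div_one_sub_mul (c := 2 / 3)
    (by norm_num; positivity) (by norm_num) (by norm_num)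
  refine ⟨fun k => Nat.casesOn k (π / 2 / √3) fun n => -d n / (n + 1), fun t ht => ?_, rfl,
    fun k hk => ?_⟩
  · have h := hasSum_integrate_monomials (p := fun k => k) (a := fun k => -d k)
      (fun t ht => by simpa using (hs t ht).neg)
      (fun t ht => hasDerivAt_ortAngle_div_sqrt ht) ht
    rw [← hasSum_nat_add_iff' 1]
    simpa [ortAngle_zero] using h
  · cases k with
    | zero => exact absurd hk (lt_irrefl 0)
    | succ n => exact div_neg_of_neg_of_pos (neg_neg_of_pos (hd n)) (by positivity)

theorem two_mul_arctan_eq_ortAngle {s : ℝ} (hs : s ^ 2 ≤ 1) :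
    2 * arctan (√3 * (√(1 - s ^ 2) / √(3 - s ^ 2))) = ortAngle (s ^ 2) := by
  have p3 : 0 < 3 - s ^ 2 := by linarith
  have p2 : 3 - 2 * s ^ 2 ≠ 0 := by linarith
  have p1 : 0 ≤ 1 - s ^ 2 := by linarith
  have hz : 0 ≤ √3 * (√(1 - s ^ 2) / √(3 - s ^ 2)) := by positivity
  have hz2 : (√3 * (√(1 - s ^ 2) / √(3 - s ^ 2))) ^ 2 = 3 * (1 - s ^ 2) / (3 - s ^ 2) := by
    rw [mul_pow, div_pow, Real.sq_sqrt (by norm_num), Real.sq_sqrt p1, Real.sq_sqrt p3.le]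
    ring
  have h0 := Real.arctan_nonneg.2 hz
  have h1 := Real.arctan_lt_pi_div_two (√3 * (√(1 - s ^ 2) / √(3 - s ^ 2)))
  rw [← Real.arccos_cos (by linarith) (by linarith :
    2 * arctan (√3 * (√(1 - s ^ 2) / √(3 - s ^ 2))) ≤ π), ortAngle, Real.cos_two_mul,
    Real.cos_sq_arctan, hz2]
  congr 1
  have p4 : 1 + 3 * (1 - s ^ 2) / (3 - s ^ 2) = 2 * (3 - 2 * s ^ 2) / (3 - s ^ 2) := by
    field_simp
    ring
  rw [p4, one_div_div]
  field_simp
  ring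

/-- The integrand of the double integral that evaluates `∫ arccos (s² / (3 - 2 s²)) / √(3 - s²)`. -/
def ortKernel (s a : ℝ) : ℝ := √(1 - s ^ 2) / (3 - s ^ 2 + a ^ 2 * (1 - s ^ 2))

theorem ortKernel_denom_pos {s : ℝ} (hs : s ^ 2 ≤ 1) (a : ℝ) :
    0 < 3 - s ^ 2 + a ^ 2 * (1 - s ^ 2) := by
  have : 0 ≤ a ^ 2 * (1 - s ^ 2) := mul_nonneg (sq_nonneg a) (by linarith)
  linarith

theorem integral_ortKernel_right {s : ℝ} (hs : s ^ 2 ≤ 1) :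
    ∫ a in (0 : ℝ)..√3, ortKernel s a = ortAngle (s ^ 2) / √(3 - s ^ 2) / 2 := by
  have p3 : 0 < 3 - s ^ 2 := by linarith
  have p1 : 0 ≤ 1 - s ^ 2 := by linarith
  have q3 := Real.sqrt_pos.2 p3
  have hd : ∀ a : ℝ, HasDerivAt
      (fun a => arctan (a * (√(1 - s ^ 2) / √(3 - s ^ 2))) / √(3 - s ^ 2)) (ortKernel s a) a := by
    intro a
    refine ((((hasDerivAt_id a).mul_const _).arctan).div_const _).congr_deriv ?_
    have h := ortKernel_denom_pos hs a
    have h' : 1 + (a * (√(1 - s ^ 2) / √(3 - s ^ 2))) ^ 2 =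
        (3 - s ^ 2 + a ^ 2 * (1 - s ^ 2)) / (3 - s ^ 2) := by
      rw [mul_pow, div_pow, Real.sq_sqrt p1, Real.sq_sqrt p3.le]
      field_simp
    rw [id_eq, h', ortKernel]
    field_simp
    rw [Real.sq_sqrt p3.le, mul_comm]
  have hc : Continuous (ortKernel s) := by
    unfold ortKernel
    exact continuous_const.div (by fun_prop) fun a => (ortKernel_denom_pos hs a).ne'
  rw [intervalIntegral.integral_eq_sub_of_hasDerivAt (fun a _ => hd a)
    (hc.intervalIntegrable _ _), ← two_mul_arctan_eq_ortAngle hs]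
  simp
  ring

theorem integral_ortKernel_left (a : ℝ) :
    ∫ s in (0 : ℝ)..1, ortKernel s a = π / 2 * ((1 - √2 / √(3 + a ^ 2)) / (1 + a ^ 2)) := by
  have hA : 0 < √(3 + a ^ 2) := by positivity
  have hsq : ∀ s ∈ Icc (0 : ℝ) 1, s ^ 2 ≤ 1 := fun s hs => by nlinarith [hs.1, hs.2]
  have hD : ∀ s ∈ Icc (0 : ℝ) 1, 0 < √(3 - s ^ 2 + a ^ 2 * (1 - s ^ 2)) := fun s hs =>
    Real.sqrt_pos.2 (ortKernel_denom_pos (hsq s hs) a)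
  have hcont : ContinuousOn (fun s => (arcsin s - √2 / √(3 + a ^ 2) *
      arcsin (√2 * s / √(3 - s ^ 2 + a ^ 2 * (1 - s ^ 2)))) / (1 + a ^ 2)) (Icc 0 1) := by
    have : ContinuousOn (fun s => √2 * s / √(3 - s ^ 2 + a ^ 2 * (1 - s ^ 2))) (Icc 0 1) :=
      ContinuousOn.div (by fun_prop) (by fun_prop) fun s hs => (hD s hs).ne'
    have := Real.continuous_arcsin.comp_continuousOn this
    have h2 := Real.continuous_arcsin.continuousOn (s := Icc (0 : ℝ) 1)
    exact (h2.sub (continuousOn_const.mul this)).div_const _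
  have hd : ∀ s ∈ Ioo (0 : ℝ) 1, HasDerivAt (fun s => (arcsin s - √2 / √(3 + a ^ 2) *
      arcsin (√2 * s / √(3 - s ^ 2 + a ^ 2 * (1 - s ^ 2)))) / (1 + a ^ 2)) (ortKernel s a) s := by
    intro s hs
    have hs' : s ^ 2 < 1 := by nlinarith [hs.1, hs.2]
    have p1 : 0 < 1 - s ^ 2 := by linarith
    have q1 := Real.sqrt_pos.2 p1
    have q := hD s (Ioo_subset_Icc_self hs)
    have hp := ortKernel_denom_pos hs'.le a
    set D := 3 - s ^ 2 + a ^ 2 * (1 - s ^ 2) with hDdef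
    have hw2 : 1 - (√2 * s / √D) ^ 2 = (3 + a ^ 2) * (1 - s ^ 2) / D := by
      rw [div_pow, mul_pow, Real.sq_sqrt (by norm_num), Real.sq_sqrt hp.le]
      field_simp
      rw [hDdef]
      ring
    have hwpos : 0 < 1 - (√2 * s / √D) ^ 2 := by rw [hw2]; positivity
    have hsqrt : √(1 - (√2 * s / √D) ^ 2) = √(3 + a ^ 2) * √(1 - s ^ 2) / √D := by
      rw [hw2, Real.sqrt_div (by positivity), Real.sqrt_mul (by positivity)]
    have hDd : HasDerivAt (fun s => 3 - s ^ 2 + a ^ 2 * (1 - s ^ 2))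
        (-(2 * s) * (1 + a ^ 2)) s := by
      have h := hasDerivAt_pow 2 s
      refine ((h.const_sub 3).add ((h.const_sub 1).const_mul (a ^ 2))).congr_deriv ?_
      simp
      ring
    have hw := ((hasDerivAt_id s).const_mul √2).div (hDd.sqrt hp.ne') q.ne'
    have hw' : HasDerivAt (fun s => √2 * s / √(3 - s ^ 2 + a ^ 2 * (1 - s ^ 2)))
        (√2 * (3 + a ^ 2) / (D * √D)) s := by
      refine hw.congr_deriv ?_
      rw [← hDdef, Real.sq_sqrt hp.le]
      field_simp
      rw [Real.sq_sqrt hp.le, hDdef, id_eq]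
      ring
    have h1 := Real.hasDerivAt_arcsin (x := √2 * s / √D) (by nlinarith) (by nlinarith)
    have h2 := Real.hasDerivAt_arcsin (x := s) (by nlinarith) (by nlinarith)
    have h3 := (h2.sub ((h1.comp s hw').const_mul (√2 / √(3 + a ^ 2)))).div_const (1 + a ^ 2)
    refine h3.congr_deriv ?_
    have e1 : √(1 - s ^ 2) ^ 2 = 1 - s ^ 2 := Real.sq_sqrt p1.le
    have e2 : √2 ^ 2 = (2 : ℝ) := Real.sq_sqrt (by norm_num)
    have e3 : √(3 + a ^ 2) ^ 2 = 3 + a ^ 2 := Real.sq_sqrt (by positivity)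
    rw [hsqrt, ortKernel, ← hDdef]
    field_simp
    rw [e1, e2, e3, hDdef]
    ring
  have hint : IntervalIntegrable (fun s => ortKernel s a) MeasureTheory.volume 0 1 := by
    refine ContinuousOn.intervalIntegrable_of_Icc zero_le_one ?_
    exact ContinuousOn.div (by fun_prop) (by fun_prop)
      fun s hs => (ortKernel_denom_pos (hsq s hs) a).ne'
  rw [intervalIntegral.integral_eq_sub_of_hasDerivAt_of_le zero_le_one hcont hd hint]
  norm_num
  ring

theorem integral_integral_ortKernel_left :
    ∫ a in (0 : ℝ)..√3, π / 2 * ((1 - √2 / √(3 + a ^ 2)) / (1 + a ^ 2)) = π ^ 2 / 24 := by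
  have hd : ∀ a : ℝ, HasDerivAt (fun a => π / 2 * (arctan a - arctan (√2 * a / √(3 + a ^ 2))))
      (π / 2 * ((1 - √2 / √(3 + a ^ 2)) / (1 + a ^ 2))) a := by
    intro a
    have hA : 0 < 3 + a ^ 2 := by positivity
    have hq := Real.sqrt_pos.2 hA
    have hAd : HasDerivAt (fun a : ℝ => 3 + a ^ 2) (2 * a) a := by
      simpa using (hasDerivAt_pow 2 a).const_add 3
    have hw := ((hasDerivAt_id a).const_mul √2).div (hAd.sqrt hA.ne') hq.ne'
    refine (((Real.hasDerivAt_arctan a).sub hw.arctan).const_mul (π / 2)).congr_deriv ?_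
    have e2 : √2 ^ 2 = (2 : ℝ) := Real.sq_sqrt (by norm_num)
    have e3 : √(3 + a ^ 2) ^ 2 = 3 + a ^ 2 := Real.sq_sqrt hA.le
    have h1 : 1 + (√2 * a / √(3 + a ^ 2)) ^ 2 = 3 * (1 + a ^ 2) / (3 + a ^ 2) := by
      rw [div_pow, mul_pow, e2, e3]
      field_simp
      ring
    simp only [Pi.div_apply, id_eq]
    rw [h1, e3]
    field_simp
    rw [e3]
    ring
  have hc : Continuous fun a : ℝ => π / 2 * ((1 - √2 / √(3 + a ^ 2)) / (1 + a ^ 2)) := by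
    refine continuous_const.mul (Continuous.div (continuous_const.sub
      (continuous_const.div (by fun_prop) fun a => ?_)) (by fun_prop) fun a => ?_) <;> positivity
  rw [intervalIntegral.integral_eq_sub_of_hasDerivAt (fun a _ => hd a)
    (hc.intervalIntegrable _ _)]
  have h6 : √2 * √3 / √(3 + √3 ^ 2) = 1 := by
    rw [Real.sq_sqrt (by norm_num), ← Real.sqrt_mul (by norm_num)]
    norm_num
  rw [h6, Real.arctan_sqrt_three, Real.arctan_one]
  simp
  ring

theorem integral_ortAngle_zero_one :
    ∫ s in (0 : ℝ)..1, ortAngle (s ^ 2) / √(3 - s ^ 2) = π ^ 2 / 12 := by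
  have hsq : ∀ s ∈ Icc (0 : ℝ) 1, s ^ 2 ≤ 1 := fun s hs => by nlinarith [hs.1, hs.2]
  have hint : MeasureTheory.IntegrableOn (Function.uncurry ortKernel)
      (uIoc (0 : ℝ) 1 ×ˢ uIoc 0 √3) := by
    have hc : ContinuousOn (Function.uncurry ortKernel) (Icc (0 : ℝ) 1 ×ˢ Icc 0 √3) := by
      unfold Function.uncurry ortKernel
      exact ContinuousOn.div (by fun_prop) (by fun_prop)
        fun p hp => (ortKernel_denom_pos (hsq p.1 hp.1) p.2).ne'
    refine (hc.integrableOn_compact (isCompact_Icc.prod isCompact_Icc)).mono_set ?_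
    rw [uIoc_of_le zero_le_one, uIoc_of_le (by positivity)]
    exact prod_mono Ioc_subset_Icc_self Ioc_subset_Icc_self
  have h := MeasureTheory.intervalIntegral_intervalIntegral_swap hint
  simp_rw [integral_ortKernel_left] at h
  rw [integral_integral_ortKernel_left] at h
  have h2 : ∫ s in (0 : ℝ)..1, ∫ a in (0 : ℝ)..√3, ortKernel s a =
      ∫ s in (0 : ℝ)..1, ortAngle (s ^ 2) / √(3 - s ^ 2) / 2 := by
    refine intervalIntegral.integral_congr fun s hs => ?_
    rw [uIcc_of_le zero_le_one] at hs
    exact integral_ortKernel_right (hsq s hs)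
  rw [h2, intervalIntegral.integral_div] at h
  linarith

theorem integral_ortAngle_neg_one_zero :
    ∫ s in (-1 : ℝ)..0, ortAngle (s ^ 2) / √(3 - s ^ 2) = π ^ 2 / 12 := by
  have h := intervalIntegral.integral_comp_neg (a := (0 : ℝ)) (b := 1)
    (fun s => ortAngle (s ^ 2) / √(3 - s ^ 2))
  simp only [neg_sq, neg_zero] at h
  rw [← h, integral_ortAngle_zero_one]

theorem hOrt2_zero : hOrt2 0 = 0 := by
  have h := integral_ortAngle_neg_one_zero
  simp only [ortAngle] at h
  rw [hOrt2, h]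
  field_simp
  norm_num

theorem continuousOn_ortAngle_sq_div_sqrt :
    ContinuousOn (fun s : ℝ => ortAngle (s ^ 2) / √(3 - s ^ 2)) (Icc (-1) 1) := by
  have hsq : ∀ s ∈ Icc (-1 : ℝ) 1, s ^ 2 ≤ 1 := fun s hs => by nlinarith [hs.1, hs.2]
  refine ContinuousOn.div (Real.continuous_arccos.comp_continuousOn
    (ContinuousOn.div (by fun_prop) (by fun_prop) fun s hs => ?_)) (by fun_prop) fun s hs => ?_
  · linarith [hsq s hs]
  · exact (Real.sqrt_pos.2 (by linarith [hsq s hs])).ne'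

theorem hasDerivAt_hOrt2 {x : ℝ} (hx : |x| < 1) :
    HasDerivAt hOrt2 (12 / π ^ 2 * (ortAngle (x ^ 2) / √(3 - x ^ 2))) x := by
  have hx' := abs_lt.1 hx
  have hc := continuousOn_ortAngle_sq_div_sqrt
  have hmem : Icc (-1 : ℝ) 1 ∈ nhds x := Icc_mem_nhds hx'.1 hx'.2
  refine ((intervalIntegral.integral_hasDerivAt_right ?_ ?_ (hc.continuousAt hmem)).const_mul
    (12 / π ^ 2)).sub_const 1
  · exact (hc.mono (Icc_subset_Icc_right hx'.2.le)).intervalIntegrable_of_Icc hx'.1.le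
  · exact ⟨_, hmem, hc.aestronglyMeasurable measurableSet_Icc⟩

/-- h has a power series ∑ c_{2k+1} x^{2k+1} about 0 convergent on (-1,1), with
c₁ = 2√3/π > 0 and c_{2k+1} < 0 for all k > 0. -/
theorem stmt_15 :
    ∃ c : ℕ → ℝ,
      (∀ x ∈ Ioo (-1 : ℝ) 1, HasSum (fun k : ℕ => c k * x ^ (2 * k + 1)) (hOrt2 x)) ∧
      c 0 = 2 * Real.sqrt 3 / π ∧ 0 < c 0 ∧ (∀ k : ℕ, 0 < k → c k < 0) := by
  obtain ⟨a, hs, ha0, ha⟩ := exists_hasSum_ortAngle_div_sqrt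
  have hc0 : 12 / π ^ 2 * a 0 / ((2 * 0 : ℕ) + 1) = 2 * √3 / π := by
    rw [ha0]
    have h3 : √3 ^ 2 = (3 : ℝ) := Real.sq_sqrt (by norm_num)
    field_simp
    rw [h3]
    norm_num
  refine ⟨fun k => 12 / π ^ 2 * a k / ((2 * k : ℕ) + 1), fun x hx => ?_, hc0, ?_, fun k hk => ?_⟩
  · have hx' : |x| < 1 := abs_lt.2 hx
    have h := hasSum_integrate_monomials (p := fun k => 2 * k) (F := hOrt2)
      (a := fun k => 12 / π ^ 2 * a k) (fun t ht => ?_) (fun t ht => hasDerivAt_hOrt2 ht) hx'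
    · rwa [hOrt2_zero, sub_zero] at h
    · have ht2 : |t ^ 2| < 1 := by
        rw [abs_pow]
        exact pow_lt_one₀ (abs_nonneg t) ht two_ne_zero
      simpa only [pow_mul, mul_assoc] using (hs _ ht2).mul_left (12 / π ^ 2)
  · dsimp only
    rw [hc0]
    positivity
  · exact div_neg_of_neg_of_pos (mul_neg_of_pos_of_neg (by positivity) (ha k hk)) (by positivity)

end
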